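/- Let (i_l,i_{l−1},…,i₁,i_{l+1},…,i_n) be a permutation of {1,…,n}. Then there exist a ℚ-linear combination N of indicator functions of plates of ordered set partitions of {1,…,n} having at least one block of size at least 2, and a function Z on V₀ⁿ vanishing outside a finite union of proper linear subspaces of V₀ⁿ, such that [[i_l,i_{l−1},…,i₁,i_{l+1},…,i_n]] = (−1)^{l−1} ∑_π [[π]] + N + Z, where π ranges over all permutations (π₁,…,πₙ) of {1,…,n} (regarded as ordered set partitions into singleton blocks) in which i₁ appears before i₂, i₂ before i₃, …, i_{l−1} before i_l, and i₁ appears before i_{l+1}, i_{l+1} before i_{l+2}, …, i_{n−1} before i_n. -/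

import Mathlib

open scoped Pointwise Classical

namespace PlatesPaper

/-- The union of a list of finite sets. -/
def lUnion {n : ℕ} (L : List (Finset (Fin n))) : Finset (Fin n) :=
  L.foldr (· ∪ ·) ∅

/-- `L` is an ordered set partition of `J`: a list of pairwise disjoint nonempty
finite sets whose union is `J`. -/
def IsOSP {n : ℕ} (J : Finset (Fin n)) (L : List (Finset (Fin n))) : Prop :=
  (∀ B ∈ L, B.Nonempty) ∧ L.Pairwise Disjoint ∧ lUnion L = J

/-- The plate of an ordered set partition `L` (of a subset `J = lUnion L` of `{1,…,n}`):
the set of `x ∈ V₀ⁿ` vanishing outside `J`, with `x_J = 0`, and such that the partial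
sums over the unions of the first `i` blocks are nonnegative for `i = 1,…,len(L)−1`.
(For an ordered set partition of the whole of `{1,…,n}` the first two conditions are
equivalent to `x ∈ V₀ⁿ`.) -/
def plate {n : ℕ} (L : List (Finset (Fin n))) : Set (Fin n → ℝ) :=
  {x | (∑ i, x i = 0) ∧ (∀ j, j ∉ lUnion L → x j = 0) ∧ (∑ j ∈ lUnion L, x j = 0) ∧
    ∀ i : ℕ, 0 < i → i < L.length → 0 ≤ ∑ j ∈ lUnion (L.take i), x j}

/-- `ℚ`-valued indicator function of a set of points of `ℝⁿ`. -/
noncomputable def ind {n : ℕ} (S : Set (Fin n → ℝ)) : (Fin n → ℝ) → ℚ :=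
  fun x => if x ∈ S then 1 else 0

/-- The index of the block of `L` containing the element `a`. -/
def blockIdx {n : ℕ} (L : List (Finset (Fin n))) (a : Fin n) : ℕ :=
  L.findIdx fun B => decide (a ∈ B)

/-- The index of the block of `L` containing the set `B`. -/
def subIdx {n : ℕ} (L : List (Finset (Fin n))) (B : Finset (Fin n)) : ℕ :=
  L.findIdx fun C => decide (B ⊆ C)

/-- `B` is contained in one of the blocks of `L`. -/
def memBlock {n : ℕ} (L : List (Finset (Fin n))) (B : Finset (Fin n)) : Prop :=
  ∃ j < L.length, B ⊆ L.getD j ∅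

/-- The list `(S_l, S_{l−1}, …, S₁, S_{l+1}, …, S_k)`. -/
def arrList (n k l : ℕ) (S : ℕ → Finset (Fin n)) : List (Finset (Fin n)) :=
  ((List.range l).map fun i => S (l - i)) ++ ((List.range (k - l)).map fun i => S (l + 1 + i))

/-- The coordinate-sum linear functional on `ℝⁿ`. -/
def sumLin (n : ℕ) : (Fin n → ℝ) →ₗ[ℝ] ℝ where
  toFun x := ∑ i, x i
  map_add' x y := by simp [Finset.sum_add_distrib]
  map_smul' c x := by simp [Finset.mul_sum]

/-- The hyperplane `V₀ⁿ = {x ∈ ℝⁿ : x₁ + ⋯ + xₙ = 0}`, as a submodule of `ℝⁿ`. -/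
def V0 (n : ℕ) : Submodule ℝ (Fin n → ℝ) := LinearMap.ker (sumLin n)

/-- The condition on the permutations `π` (ordered set partitions of `{1,…,n}` into
singleton blocks) appearing in the straightening formula in `𝒫₁ⁿ`: `i₁` appears before
`i₂`, …, `i_{l−1}` before `i_l`, and `i₁` appears before `i_{l+1}`, `i_{l+1}` before
`i_{l+2}`, …, `i_{n−1}` before `i_n`.  (Here `v a` denotes `i_a`.) -/
def PermCond (n l : ℕ) (v : ℕ → Fin n) (π : List (Finset (Fin n))) : Prop :=
  IsOSP Finset.univ π ∧ (∀ B ∈ π, B.card = 1) ∧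
  (∀ a : ℕ, 1 ≤ a → a < l → blockIdx π (v a) < blockIdx π (v (a + 1))) ∧
  (l < n → blockIdx π (v 1) < blockIdx π (v (l + 1))) ∧
  (∀ a : ℕ, l + 1 ≤ a → a < n → blockIdx π (v a) < blockIdx π (v (a + 1)))

/-! ### Auxiliary notions -/

/-- `x_B` summed over a list of blocks. -/
def sumF {n : ℕ} (x : Fin n → ℝ) (L : List (Finset (Fin n))) : ℝ :=
  (L.map fun B => ∑ j ∈ B, x j).sum

/-- All nonempty suffixes have negative sum. -/
def sufNeg {n : ℕ} (x : Fin n → ℝ) : List (Finset (Fin n)) → Prop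
  | [] => True
  | B :: L => sumF x (B :: L) < 0 ∧ sufNeg x L

/-- All nonempty suffixes have nonzero sum. -/
def sufNZ {n : ℕ} (x : Fin n → ℝ) : List (Finset (Fin n)) → Prop
  | [] => True
  | B :: L => sumF x (B :: L) ≠ 0 ∧ sufNZ x L

/-- All nonempty proper prefixes have nonnegative sum, after adding `s`. -/
def poss {n : ℕ} (x : Fin n → ℝ) : ℝ → List (Finset (Fin n)) → Prop
  | _, [] => True
  | _, [_] => True
  | s, B :: C :: L => 0 ≤ s + ∑ j ∈ B, x j ∧ poss x (s + ∑ j ∈ B, x j) (C :: L)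

/-- Generic points of the hyperplane. -/
def gen {n : ℕ} (x : Fin n → ℝ) : Prop :=
  ∑ i, x i = 0 ∧ ∀ S : Finset (Fin n), S.Nonempty → S ≠ Finset.univ → ∑ j ∈ S, x j ≠ 0

/-- The span of the lumped plates. -/
def NS (n : ℕ) : Submodule ℚ ((Fin n → ℝ) → ℚ) :=
  Submodule.span ℚ {f : (Fin n → ℝ) → ℚ |
        ∃ L : List (Finset (Fin n)), IsOSP Finset.univ L ∧ (∃ B ∈ L, 2 ≤ B.card) ∧
          f = ind (plate L)}

/-- Functions vanishing at generic points. -/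
def ZS (n : ℕ) : Submodule ℚ ((Fin n → ℝ) → ℚ) where
  carrier := {f | ∀ x, gen x → f x = 0}
  zero_mem' := by intro x _; rfl
  add_mem' := by
    intro f g hf hg x hx
    simp [hf x hx, hg x hx]
  smul_mem' := by
    intro c f hf x hx
    simp [hf x hx]

/-- The sum of the two. -/
def MS (n : ℕ) : Submodule ℚ ((Fin n → ℝ) → ℚ) := NS n ⊔ ZS n

theorem mem_lUnion {n : ℕ} (L : List (Finset (Fin n))) (a : Fin n) :
    a ∈ lUnion L ↔ ∃ B ∈ L, a ∈ B := by
  induction L with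
  | nil => simp [lUnion]
  | cons B L ih =>
    have : lUnion (B :: L) = B ∪ lUnion L := rfl
    rw [this, Finset.mem_union, ih]
    simp

theorem IsOSP.perm {n : ℕ} {J : Finset (Fin n)} {L L' : List (Finset (Fin n))}
    (h : IsOSP J L) (hp : L.Perm L') : IsOSP J L' := by
  obtain ⟨h1, h2, h3⟩ := h
  refine ⟨fun B hB => h1 B (hp.mem_iff.2 hB), ?_, ?_⟩
  · exact (hp.pairwise_iff (fun h => Disjoint.symm h)).1 h2
  · rw [← h3]
    ext a
    simp only [mem_lUnion]
    constructor
    · rintro ⟨B, hB, ha⟩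
      exact ⟨B, hp.mem_iff.2 hB, ha⟩
    · rintro ⟨B, hB, ha⟩
      exact ⟨B, hp.mem_iff.1 hB, ha⟩

theorem IsOSP.nodup {n : ℕ} {J : Finset (Fin n)} {L : List (Finset (Fin n))}
    (h : IsOSP J L) : L.Nodup := by
  obtain ⟨h1, h2, h3⟩ := h
  unfold List.Nodup
  refine List.Pairwise.imp_of_mem ?_ h2
  intro a b ha hb hab he
  subst he
  exact (h1 a ha).ne_empty (disjoint_self.1 hab)

theorem sumF_cons {n : ℕ} (x : Fin n → ℝ) (B : Finset (Fin n)) (L : List (Finset (Fin n))) :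
    sumF x (B :: L) = ∑ j ∈ B, x j + sumF x L := by simp [sumF]

theorem sumF_append {n : ℕ} (x : Fin n → ℝ) (L L' : List (Finset (Fin n))) :
    sumF x (L ++ L') = sumF x L + sumF x L' := by simp [sumF]

theorem sumF_perm {n : ℕ} (x : Fin n → ℝ) {L L' : List (Finset (Fin n))} (h : L.Perm L') :
    sumF x L = sumF x L' := (h.map _).sum_eq

theorem sumF_eq {n : ℕ} (x : Fin n → ℝ) (L : List (Finset (Fin n)))
    (h : L.Pairwise Disjoint) : sumF x L = ∑ j ∈ lUnion L, x j := by
  induction L with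
  | nil => simp [sumF, lUnion]
  | cons B L ih =>
    have h0 : lUnion (B :: L) = B ∪ lUnion L := rfl
    rw [List.pairwise_cons] at h
    rw [h0, Finset.sum_union, sumF_cons, ih h.2]
    rw [Finset.disjoint_left]
    intro a ha ha'
    obtain ⟨C, hC, haC⟩ := (mem_lUnion _ _).1 ha'
    exact (Finset.disjoint_left.1 (h.1 C hC)) ha haC

theorem sumF_univ {n : ℕ} {x : Fin n → ℝ} (hx : gen x) {L : List (Finset (Fin n))}
    (h : IsOSP Finset.univ L) : sumF x L = 0 := by
  rw [sumF_eq x L h.2.1, h.2.2]; exact hx.1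

theorem sumF_ne {n : ℕ} {x : Fin n → ℝ} (hx : gen x) {L P R : List (Finset (Fin n))}
    (h : IsOSP Finset.univ L) (hp : L.Perm (P ++ R)) (hP : P ≠ []) (hR : R ≠ []) :
    sumF x R ≠ 0 := by
  have h' := h.perm hp
  have hd := List.pairwise_append.1 h'.2.1
  rw [sumF_eq x R hd.2.1]
  apply hx.2
  · obtain ⟨B, hB⟩ := List.exists_mem_of_ne_nil R hR
    obtain ⟨a, ha⟩ := h'.1 B (by simp [hB])
    exact ⟨a, (mem_lUnion _ _).2 ⟨B, hB, ha⟩⟩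
  · obtain ⟨B, hB⟩ := List.exists_mem_of_ne_nil P hP
    obtain ⟨a, ha⟩ := h'.1 B (by simp [hB])
    intro he
    have : a ∈ lUnion R := by rw [he]; simp
    obtain ⟨C, hC, haC⟩ := (mem_lUnion _ _).1 this
    exact Finset.disjoint_left.1 (hd.2.2 B hB C hC) ha haC

theorem sufNZ_of {n : ℕ} {x : Fin n → ℝ} (hx : gen x) (R : List (Finset (Fin n))) :
    ∀ {L P : List (Finset (Fin n))},
    IsOSP Finset.univ L → L.Perm (P ++ R) → P ≠ [] → sufNZ x R := by
  induction R with
  | nil => intros; trivial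
  | cons B R ih =>
    intro L P h hp hP
    refine ⟨sumF_ne hx h hp hP (by simp), ?_⟩
    refine ih (P := P ++ [B]) h ?_ (by simp)
    simpa using hp

theorem poss_snoc {n : ℕ} (x : Fin n → ℝ) (B : Finset (Fin n)) (P : List (Finset (Fin n))) :
    ∀ s, P ≠ [] → (poss x s (P ++ [B]) ↔ poss x s P ∧ 0 ≤ s + sumF x P) := by
  induction P with
  | nil => intro s h; exact absurd rfl h
  | cons C P ih =>
    intro s _
    cases P with
    | nil => simp [poss, sumF]
    | cons D P =>
      have := ih (s + ∑ j ∈ C, x j) (by simp)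
      simp only [List.cons_append] at this ⊢
      simp only [poss]
      rw [this, sumF_cons x C]
      rw [and_assoc, add_assoc]

theorem poss_append {n : ℕ} (x : Fin n → ℝ) (W : List (Finset (Fin n))) :
    ∀ (P : List (Finset (Fin n))) (s : ℝ), P ≠ [] → s + sumF x P + sumF x W = 0 → sufNZ x W →
      (poss x s (P ++ W) ↔ poss x s P ∧ sufNeg x W) := by
  induction W with
  | nil => intro P s _ _ _; simp [sufNeg]
  | cons B W ih =>
    intro P s hP hs hW
    have := ih (P ++ [B]) s (by simp) (by rw [sumF_append]; rw [sumF_cons] at hs; simp [sumF] at hs ⊢; linarith) hW.2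
    rw [List.append_assoc] at this
    rw [List.singleton_append] at this
    rw [this, poss_snoc x B P s hP]
    simp only [sufNeg]
    have hne := hW.1
    have : 0 ≤ s + sumF x P ↔ sumF x (B :: W) < 0 := by
      constructor
      · intro h; exact lt_of_le_of_ne (by linarith) hne
      · intro h; linarith
    rw [this, and_assoc]

theorem poss_iff {n : ℕ} (x : Fin n → ℝ) (L : List (Finset (Fin n))) :
    ∀ s, L.Pairwise Disjoint →
    (poss x s L ↔ ∀ i : ℕ, 0 < i → i < L.length → 0 ≤ s + ∑ j ∈ lUnion (L.take i), x j) := by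
  intro s hd
  have key : ∀ i, ∑ j ∈ lUnion (L.take i), x j = sumF x (L.take i) := fun i =>
    (sumF_eq x _ (hd.sublist (List.take_sublist i L))).symm
  simp only [key]
  clear key hd
  induction L generalizing s with
  | nil => simp [poss]
  | cons B L ih =>
    cases L with
    | nil => simp only [poss, true_iff]; intro i h1 h2; simp at h2; omega
    | cons C L =>
      simp only [poss]
      refine (and_congr_right' (ih _)).trans ?_
      constructor
      · rintro ⟨h1, h2⟩ i hi hi'
        obtain ⟨k, rfl⟩ : ∃ k, i = k + 1 := ⟨i - 1, by omega⟩
        rw [List.take_succ_cons, sumF_cons, ← add_assoc]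
        rcases Nat.eq_zero_or_pos k with rfl | hk
        · simpa [sumF] using h1
        · exact h2 k hk (by simpa using hi')
      · intro h
        refine ⟨by simpa [sumF] using h 1 (by simp) (by simp), fun k hk hk' => ?_⟩
        have := h (k + 1) (by simp) (by simpa using hk')
        rwa [List.take_succ_cons, sumF_cons, ← add_assoc] at this

theorem mem_plate {n : ℕ} {x : Fin n → ℝ} (hx : gen x) {L : List (Finset (Fin n))}
    (h : IsOSP Finset.univ L) : x ∈ plate L ↔ poss x 0 L := by
  rw [poss_iff x L 0 h.2.1]
  simp only [plate, Set.mem_ofPred_eq, h.2.2, hx.1]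
  simp

theorem ZS_le {n : ℕ} {f : (Fin n → ℝ) → ℚ} (h : ∀ x, gen x → f x = 0) : f ∈ MS n :=
  Submodule.mem_sup_right h

theorem NS_le {n : ℕ} {L : List (Finset (Fin n))} (h : IsOSP Finset.univ L)
    (h2 : ∃ B ∈ L, 2 ≤ B.card) : ind (plate L) ∈ MS n :=
  Submodule.mem_sup_left (Submodule.subset_span ⟨L, h, h2, rfl⟩)

theorem IsOSP.merge {n : ℕ} {J a b : Finset (Fin n)} {L : List (Finset (Fin n))}
    (h : IsOSP J (a :: b :: L)) :
    IsOSP J ((a ∪ b) :: L) ∧ 2 ≤ (a ∪ b).card ∧ Disjoint a b := by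
  obtain ⟨h1, h2, h3⟩ := h
  simp only [List.pairwise_cons, List.mem_cons, forall_eq_or_imp] at h1 h2
  refine ⟨⟨?_, ?_, ?_⟩, ?_, h2.1.1⟩
  · intro B hB
    rcases List.mem_cons.1 hB with rfl | hB
    · exact h1.1.mono Finset.subset_union_left
    · exact h1.2.2 B hB
  · rw [List.pairwise_cons]
    refine ⟨fun B hB => ?_, h2.2.2⟩
    rw [Finset.disjoint_union_left]
    exact ⟨h2.1.2 B hB, h2.2.1 B hB⟩
  · rw [← h3]; simp [lUnion, Finset.union_assoc]
  · rw [Finset.card_union_of_disjoint h2.1.1]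
    have := h1.1.card_pos
    have := h1.2.1.card_pos
    omega

/-- first `k` prefixes negative, the remaining ones nonnegative -/
noncomputable def XF {n : ℕ} (A B : List (Finset (Fin n))) : (Fin n → ℝ) → ℚ :=
  fun x => if sufNeg x A ∧ poss x (sumF x A) B then 1 else 0

theorem XF_mem {n : ℕ} (A : List (Finset (Fin n))) : ∀ (b : Finset (Fin n)) B,
    IsOSP Finset.univ (A.reverse ++ b :: B) →
    XF A (b :: B) - (-1 : ℚ) ^ A.length • ind (plate (A.reverse ++ b :: B)) ∈ MS n := by
  induction A with
  | nil =>
    intro b B h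
    apply ZS_le
    intro x hx
    simp only [List.reverse_nil, List.nil_append] at h ⊢
    simp [XF, ind, mem_plate hx h, sufNeg, sumF]
  | cons a A ih =>
    intro b B h
    have h0 : IsOSP Finset.univ (A.reverse ++ a :: b :: B) := by simpa using h
    have hp : (A.reverse ++ a :: b :: B).Perm (a :: b :: (A.reverse ++ B)) :=
      List.perm_middle.trans (List.Perm.cons _ List.perm_middle)
    obtain ⟨m1, m2, m3⟩ := (h0.perm hp).merge
    have m1' : IsOSP Finset.univ (A.reverse ++ (a ∪ b) :: B) := m1.perm List.perm_middle.symm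
    have i1 := ih (a ∪ b) B m1'
    have i2 := ih a (b :: B) h0
    have i3 := NS_le m1' ⟨a ∪ b, by simp, m2⟩
    have hz : XF (a :: A) (b :: B) - XF A ((a ∪ b) :: B) + XF A (a :: b :: B) ∈ MS n := by
      apply ZS_le
      intro x hx
      have e1 : poss x (sumF x A) ((a ∪ b) :: B) ↔ poss x (sumF x A + ∑ j ∈ a, x j) (b :: B) := by
        cases B with
        | nil => simp [poss]
        | cons c B => simp only [poss]; rw [Finset.sum_union m3, add_assoc]
      simp only [XF, Pi.add_apply, Pi.sub_apply, e1]
      simp only [poss, sufNeg, sumF_cons]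
      rw [add_comm (∑ j ∈ a, x j)]
      by_cases q1 : sufNeg x A <;> by_cases q2 : poss x (sumF x A + ∑ j ∈ a, x j) (b :: B) <;>
        by_cases q3 : 0 ≤ sumF x A + ∑ j ∈ a, x j <;> simp [q1, q2, q3, not_lt.2, not_le.1]
    have : XF (a :: A) (b :: B) - (-1 : ℚ) ^ (a :: A).length • ind (plate ((a :: A).reverse ++ b :: B))
      = (XF (a :: A) (b :: B) - XF A ((a ∪ b) :: B) + XF A (a :: b :: B))
        + (XF A ((a ∪ b) :: B) - (-1 : ℚ) ^ A.length • ind (plate (A.reverse ++ (a ∪ b) :: B)))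
        + (-1 : ℚ) ^ A.length • ind (plate (A.reverse ++ (a ∪ b) :: B))
        - (XF A (a :: b :: B) - (-1 : ℚ) ^ A.length • ind (plate (A.reverse ++ a :: b :: B))) := by
      simp only [List.reverse_cons, List.append_assoc, List.singleton_append, List.length_cons, pow_succ]
      module
    rw [this]
    exact Submodule.sub_mem _ (Submodule.add_mem _ (Submodule.add_mem _ hz i1)
      (Submodule.smul_mem _ _ i3)) i2

/-- shuffles -/
noncomputable def shF {n : ℕ} (U W : List (Finset (Fin n))) : Finset (List (Finset (Fin n))) :=
  (U ++ W).permutations.toFinset.filter fun σ => U.Sublist σ ∧ W.Sublist σ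

theorem mem_shF {n : ℕ} {U W σ : List (Finset (Fin n))} :
    σ ∈ shF U W ↔ σ.Perm (U ++ W) ∧ U.Sublist σ ∧ W.Sublist σ := by
  simp [shF, List.mem_permutations]

theorem shF_nil_left {n : ℕ} (W : List (Finset (Fin n))) : shF [] W = {W} := by
  ext σ
  rw [mem_shF, Finset.mem_singleton]
  constructor
  · rintro ⟨h1, h2, h3⟩
    exact (h3.eq_of_length (by simpa using h1.length_eq.symm)).symm
  · rintro rfl; simp

theorem shF_nil_right {n : ℕ} (W : List (Finset (Fin n))) : shF W [] = {W} := by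
  ext σ
  rw [mem_shF, Finset.mem_singleton]
  constructor
  · rintro ⟨h1, h2, h3⟩
    exact (h2.eq_of_length (by simpa using h1.length_eq.symm)).symm
  · rintro rfl; simp

theorem shF_cons {n : ℕ} (u w : Finset (Fin n)) (U W : List (Finset (Fin n)))
    (hn : (u :: U ++ w :: W).Nodup) :
    shF (u :: U) (w :: W) = (shF U (w :: W)).image (List.cons u) ∪
      (shF (u :: U) W).image (List.cons w) := by
  ext σ
  simp only [Finset.mem_union, Finset.mem_image, mem_shF]
  have huw : u ≠ w := by rintro rfl; simp at hn
  constructor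
  · rintro ⟨h1, h2, h3⟩
    have hσ : σ.Nodup := h1.nodup_iff.2 hn
    cases σ with
    | nil => simp at h2
    | cons c σ =>
      by_cases hu : c = u
      · subst hu
        left
        refine ⟨σ, ⟨?_, ?_, ?_⟩, rfl⟩
        · simpa using h1
        · simpa using h2
        · cases h3 with
          | cons _ h => exact h
          | cons_cons _ h => exact absurd rfl huw
      · have h2' : (u :: U).Sublist σ := by
          cases h2 with
          | cons _ h => exact h
          | cons_cons _ h => exact absurd rfl hu
        by_cases hw : c = w
        · subst hw
          right
          refine ⟨σ, ⟨?_, h2', ?_⟩, rfl⟩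
          · exact (List.perm_cons c).1 (h1.trans List.perm_middle)
          · simpa using h3
        · have h3' : (w :: W).Sublist σ := by
            cases h3 with
            | cons _ h => exact h
            | cons_cons _ h => exact absurd rfl hw
          exfalso
          have : c ∈ u :: U ++ w :: W := h1.mem_iff.1 (by simp)
          have hc : c ∉ σ := (List.nodup_cons.1 hσ).1
          rcases List.mem_append.1 this with h | h
          · exact hc (h2'.subset h)
          · exact hc (h3'.subset h)
  · rintro (⟨σ, ⟨h1, h2, h3⟩, rfl⟩ | ⟨σ, ⟨h1, h2, h3⟩, rfl⟩)
    · exact ⟨by simpa using h1, by simpa using h2, h3.cons _⟩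
    · exact ⟨(h1.cons w).trans List.perm_middle.symm, h2.cons _, by simpa using h3⟩

/-- partially resolved shuffle -/
noncomputable def EF {n : ℕ} (P U W : List (Finset (Fin n))) : (Fin n → ℝ) → ℚ :=
  fun x => if poss x 0 P ∧ sufNeg x U ∧ sufNeg x W then 1 else 0

theorem EF_base {n : ℕ} (P W : List (Finset (Fin n))) (hP : P ≠ [])
    (h : IsOSP Finset.univ (P ++ W)) {x : Fin n → ℝ} (hx : gen x) :
    ind (plate (P ++ W)) x = if poss x 0 P ∧ sufNeg x W then 1 else 0 := by
  have := sumF_univ hx h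
  rw [sumF_append] at this
  simp only [ind, mem_plate hx h]
  rw [poss_append x W P 0 hP (by linarith) (sufNZ_of hx W h (List.Perm.refl _) hP)]
  split_ifs <;> rfl

theorem EF_mem {n : ℕ} (U : List (Finset (Fin n))) : ∀ (W P : List (Finset (Fin n))), P ≠ [] →
    IsOSP Finset.univ (P ++ (U ++ W)) →
    EF P U W - ∑ σ ∈ shF U W, ind (plate (P ++ σ)) ∈ MS n := by
  induction U with
  | nil =>
    intro W P hP h
    apply ZS_le
    intro x hx
    rw [shF_nil_left]
    simp only [List.nil_append] at h
    simp only [Finset.sum_singleton, Pi.sub_apply, EF_base P W hP h hx]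
    simp [EF, sufNeg]
  | cons u U ihU =>
    intro W
    induction W with
    | nil =>
      intro P hP h
      apply ZS_le
      intro x hx
      rw [shF_nil_right]
      rw [List.append_nil] at h
      simp only [Finset.sum_singleton, Pi.sub_apply, EF_base P _ hP h hx]
      by_cases q1 : poss x 0 P ∧ sufNeg x (u :: U)
      · have q2 : poss x 0 P ∧ sufNeg x (u :: U) ∧ sufNeg x [] := ⟨q1.1, q1.2, trivial⟩
        simp only [EF]
        rw [if_pos q1, if_pos q2, sub_self]
      · have q2 : ¬ (poss x 0 P ∧ sufNeg x (u :: U) ∧ sufNeg x []) := fun q => q1 ⟨q.1, q.2.1⟩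
        simp only [EF]
        rw [if_neg q1, if_neg q2, sub_self]
    | cons w W ihW =>
      intro P hP h
      have hn : (u :: U ++ w :: W).Nodup := (List.nodup_append.1 h.nodup).2.1
      have huw : u ≠ w := by rintro rfl; simp at hn
      have hp : (P ++ (u :: U ++ w :: W)).Perm (u :: w :: (P ++ (U ++ W))) := by
        refine List.perm_middle.trans (List.Perm.cons _ ?_)
        change (P ++ (U ++ w :: W)).Perm _
        rw [← List.append_assoc, ← List.append_assoc]
        exact List.perm_middle
      obtain ⟨m1, m2, m3⟩ := (h.perm hp).merge
      have m1' : IsOSP Finset.univ ((P ++ [u ∪ w]) ++ (U ++ W)) := by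
        apply m1.perm
        simp [List.perm_middle.symm]
      have i1 := ihU (w :: W) (P ++ [u]) (by simp) (by simpa using h)
      have i2 := ihW (P ++ [w]) (by simp) (by
        apply h.perm
        simp only [List.append_assoc]
        apply List.Perm.append_left
        exact List.perm_middle)
      have i3 := ihU W (P ++ [u ∪ w]) (by simp) m1'
      have i4 : ∑ σ ∈ shF U W, ind (plate ((P ++ [u ∪ w]) ++ σ)) ∈ MS n := by
        apply Submodule.sum_mem
        intro σ hσ
        apply NS_le
        · exact m1'.perm ((mem_shF.1 hσ).1.symm.append_left _)
        · exact ⟨u ∪ w, by simp, m2⟩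
      have hs : ∑ σ ∈ shF (u :: U) (w :: W), ind (plate (P ++ σ)) =
          ∑ σ ∈ shF U (w :: W), ind (plate ((P ++ [u]) ++ σ)) +
          ∑ σ ∈ shF (u :: U) W, ind (plate ((P ++ [w]) ++ σ)) := by
        rw [shF_cons u w U W hn, Finset.sum_union, Finset.sum_image, Finset.sum_image]
        · simp
        · intro a _ b _ hab; simpa using hab
        · intro a _ b _ hab; simpa using hab
        · rw [Finset.disjoint_left]
          intro σ h1 h2
          obtain ⟨a, _, rfl⟩ := Finset.mem_image.1 h1
          obtain ⟨b, _, hb⟩ := Finset.mem_image.1 h2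
          simp at hb
          exact huw hb.1.symm
      have hz : EF P (u :: U) (w :: W) - EF (P ++ [u]) U (w :: W) - EF (P ++ [w]) (u :: U) W
          + EF (P ++ [u ∪ w]) U W ∈ MS n := by
        apply ZS_le
        intro x hx
        have t0 := sumF_univ hx h
        rw [sumF_append, sumF_append] at t0
        have t1 : sumF x (u :: U ++ w :: W) ≠ 0 := sumF_ne hx h (List.Perm.refl _) hP (by simp)
        rw [sumF_append] at t1
        simp only [EF, Pi.add_apply, Pi.sub_apply, poss_snoc x _ P 0 hP, sufNeg]
        by_cases q1 : poss x 0 P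
        · by_cases q2 : sufNeg x U
          · by_cases q3 : sufNeg x W
            · simp only [q1, q2, q3, true_and, and_true, zero_add]
              by_cases q4 : sumF x (u :: U) < 0 <;> by_cases q5 : sumF x (w :: W) < 0
              · have : 0 ≤ sumF x P := by linarith
                simp [q4, q5, this]
              · simp [q4, q5]
              · simp [q4, q5]
              · have : ¬ 0 ≤ sumF x P := by
                  intro h'
                  apply t1
                  linarith
                simp [q4, q5, this]
            · simp [q3]
          · simp [q2]
        · simp [q1]
      have : EF P (u :: U) (w :: W) - ∑ σ ∈ shF (u :: U) (w :: W), ind (plate (P ++ σ)) =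
          (EF P (u :: U) (w :: W) - EF (P ++ [u]) U (w :: W) - EF (P ++ [w]) (u :: U) W
            + EF (P ++ [u ∪ w]) U W)
          + (EF (P ++ [u]) U (w :: W) - ∑ σ ∈ shF U (w :: W), ind (plate ((P ++ [u]) ++ σ)))
          + (EF (P ++ [w]) (u :: U) W - ∑ σ ∈ shF (u :: U) W, ind (plate ((P ++ [w]) ++ σ)))
          - (EF (P ++ [u ∪ w]) U W - ∑ σ ∈ shF U W, ind (plate ((P ++ [u ∪ w]) ++ σ)))
          - ∑ σ ∈ shF U W, ind (plate ((P ++ [u ∪ w]) ++ σ)) := by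
        rw [hs]; abel
      rw [this]
      exact Submodule.sub_mem _ (Submodule.sub_mem _ (Submodule.add_mem _ (Submodule.add_mem _ hz i1) i2) i3) i4

/-- the main congruence -/
theorem main_mem {n : ℕ} (b : Finset (Fin n)) (U W : List (Finset (Fin n)))
    (h : IsOSP Finset.univ (U.reverse ++ b :: W)) :
    ind (plate (U.reverse ++ b :: W)) - (-1 : ℚ) ^ U.length •
      ∑ σ ∈ shF U W, ind (plate (b :: σ)) ∈ MS n := by
  have hp : (U.reverse ++ b :: W).Perm ([b] ++ (U ++ W)) :=
    List.perm_middle.trans (List.Perm.cons _ ((List.reverse_perm U).append_right W))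
  have h1 := XF_mem U b W h
  have h2 := EF_mem U W [b] (by simp) (h.perm hp)
  have hz : XF U (b :: W) - EF [b] U W ∈ MS n := by
    apply ZS_le
    intro x hx
    have t0 := sumF_univ hx h
    rw [sumF_append, sumF_perm x (List.reverse_perm U)] at t0
    have t1 : sufNZ x W := sufNZ_of hx W (P := U.reverse ++ [b]) h (by simp) (by simp)
    have := poss_append x W [b] (sumF x U) (by simp)
      (by rw [sumF_cons] at t0; rw [sumF_cons]; simp [sumF] at t0 ⊢; linarith) t1
    simp only [List.singleton_append] at this
    simp [XF, EF, this, poss]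
  have hsq : (-1 : ℚ) ^ U.length * (-1 : ℚ) ^ U.length = 1 := by
    rw [← mul_pow]; simp
  have : ind (plate (U.reverse ++ b :: W)) - (-1 : ℚ) ^ U.length •
      ∑ σ ∈ shF U W, ind (plate (b :: σ)) =
      (-1 : ℚ) ^ U.length • ((XF U (b :: W) - EF [b] U W)
        + (EF [b] U W - ∑ σ ∈ shF U W, ind (plate ([b] ++ σ)))
        - (XF U (b :: W) - (-1 : ℚ) ^ U.length • ind (plate (U.reverse ++ b :: W)))) := by
    simp only [List.singleton_append]
    rw [sub_add_sub_cancel, sub_sub_sub_cancel_left, smul_sub, smul_smul, hsq, one_smul]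
  rw [this]
  exact Submodule.smul_mem _ _ (Submodule.sub_mem _ (Submodule.add_mem _ hz h2) h1)

theorem blockIdx_eq {n : ℕ} (π : List (Finset (Fin n))) (h : ∀ B ∈ π, B.card = 1) (a : Fin n) :
    blockIdx π a = π.idxOf {a} := by
  induction π with
  | nil => simp [blockIdx]
  | cons B π ih =>
    have ih' := ih (fun C hC => h C (by simp [hC]))
    obtain ⟨b, rfl⟩ := Finset.card_eq_one.1 (h B (by simp))
    unfold blockIdx at ih' ⊢
    rw [List.findIdx_cons, List.idxOf_cons, ih']
    by_cases hab : b = a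
    · subst hab; simp
    · have : ¬ a = b := fun h => hab h.symm
      have h3 : (({b} : Finset (Fin n)) == {a}) = false := by
        rw [beq_eq_false_iff_ne]
        simpa using hab
      rw [h3]
      simp [this]

theorem pairwise_idx {α : Type*} [DecidableEq α] (π : List α) (h : π.Nodup) :
    π.Pairwise (fun a b => π.idxOf a < π.idxOf b) := by
  rw [List.pairwise_iff_getElem]
  intro i j hi hj hij
  rw [h.idxOf_getElem, h.idxOf_getElem]
  exact hij

theorem sublist_iff_idx {α : Type*} [DecidableEq α] (π l : List α) (h : π.Nodup)
    (hl : l.Nodup) (hs : l ⊆ π) :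
    l.Sublist π ↔ l.Pairwise (fun a b => π.idxOf a < π.idxOf b) := by
  constructor
  · intro h'
    exact (pairwise_idx π h).sublist h'
  · intro h'
    let r : α → α → Prop := fun a b => π.idxOf a < π.idxOf b
    have : Std.Antisymm r := ⟨fun a b h1 h2 => absurd (lt_trans h1 h2) (lt_irrefl _)⟩
    exact List.sublist_of_subperm_of_pairwise (r := r) (hl.subperm hs) h' (pairwise_idx π h)

theorem sublist_iff_chain {α : Type*} [DecidableEq α] (π l : List α) (h : π.Nodup)
    (hl : l.Nodup) (hs : l ⊆ π) :
    l.Sublist π ↔ ∀ (i : ℕ) (hi : i + 1 < l.length), π.idxOf l[i] < π.idxOf l[i + 1] := by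
  rw [sublist_iff_idx π l h hl hs]
  have : Trans (fun a b : α => π.idxOf a < π.idxOf b) (fun a b : α => π.idxOf a < π.idxOf b)
    (fun a b : α => π.idxOf a < π.idxOf b) := ⟨fun h1 h2 => lt_trans h1 h2⟩
  rw [← List.isChain_iff_pairwise, List.isChain_iff_getElem]

/-- the list `i₂,…,i_l` -/
def UL (n l : ℕ) (v : ℕ → Fin n) : List (Finset (Fin n)) :=
  (List.range (l - 1)).map fun i => {v (i + 2)}

/-- the list `i_{l+1},…,i_n` -/
def WL (n l : ℕ) (v : ℕ → Fin n) : List (Finset (Fin n)) :=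
  (List.range (n - l)).map fun i => {v (l + 1 + i)}

theorem arr_eq (n l : ℕ) (hl : 1 ≤ l) (v : ℕ → Fin n) :
    arrList n n l (fun i => ({v i} : Finset (Fin n))) =
      (UL n l v).reverse ++ {v 1} :: WL n l v := by
  have : ((List.range l).map fun i => ({v (l - i)} : Finset (Fin n))) =
      (UL n l v).reverse ++ [{v 1}] := by
    apply List.ext_getElem
    · simp [UL]; omega
    · intro i h1 h2
      simp only [List.length_map, List.length_range] at h1
      rw [List.getElem_append]
      split_ifs with h
      · simp [UL] at h ⊢
        congr 1; omega
      · simp [UL] at h ⊢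
        congr 1; omega
  unfold arrList
  rw [this]
  simp [WL]

theorem permCond_iff (n l : ℕ) (hl : 1 ≤ l) (hln : l ≤ n) (v : ℕ → Fin n)
    (h : IsOSP Finset.univ ((UL n l v).reverse ++ {v 1} :: WL n l v))
    (π : List (Finset (Fin n))) :
    PermCond n l v π ↔ ∃ σ ∈ shF (UL n l v) (WL n l v), {v 1} :: σ = π := by
  have hp : ((UL n l v).reverse ++ {v 1} :: WL n l v).Perm ({v 1} :: (UL n l v ++ WL n l v)) :=
    List.perm_middle.trans (List.Perm.cons _ ((List.reverse_perm _).append_right _))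
  have h' := h.perm hp
  have hcard : ∀ B ∈ ({v 1} : Finset (Fin n)) :: (UL n l v ++ WL n l v), B.card = 1 := by
    intro B hB
    simp only [List.mem_cons, List.mem_append, UL, WL, List.mem_map] at hB
    rcases hB with rfl | ⟨_, _, rfl⟩ | ⟨_, _, rfl⟩ <;> simp
  have hnd := h'.nodup
  have s1 : (({v 1} : Finset (Fin n)) :: UL n l v).Sublist ({v 1} :: (UL n l v ++ WL n l v)) :=
    (List.sublist_append_left _ _).cons_cons _
  have s2 : (({v 1} : Finset (Fin n)) :: WL n l v).Sublist ({v 1} :: (UL n l v ++ WL n l v)) :=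
    (List.sublist_append_right _ _).cons_cons _
  have hU : ∀ i (hi : i < (({v 1} : Finset (Fin n)) :: UL n l v).length),
      (({v 1} : Finset (Fin n)) :: UL n l v)[i] = {v (i + 1)} := by
    intro i hi
    cases i <;> simp [UL]
  have hUl : (({v 1} : Finset (Fin n)) :: UL n l v).length = l := by simp [UL]; omega
  have hWl : (WL n l v).length = n - l := by simp [WL]
  have hW : ∀ i (hi : i < (WL n l v).length), (WL n l v)[i] = {v (l + 1 + i)} := by
    intro i hi
    simp [WL]
  -- the index description of the two sublist conditions
  have key : ∀ π : List (Finset (Fin n)), π.Perm ({v 1} :: (UL n l v ++ WL n l v)) →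
      (PermCond n l v π ↔ (({v 1} : Finset (Fin n)) :: UL n l v).Sublist π ∧
        (({v 1} : Finset (Fin n)) :: WL n l v).Sublist π) := by
    intro π hπ
    have hπc : ∀ B ∈ π, B.card = 1 := fun B hB => hcard B (hπ.mem_iff.1 hB)
    have hπn : π.Nodup := hπ.nodup_iff.2 hnd
    rw [sublist_iff_chain π _ hπn (hnd.sublist s1) (fun a ha => hπ.mem_iff.2 (s1.subset ha)),
      sublist_iff_chain π _ hπn (hnd.sublist s2) (fun a ha => hπ.mem_iff.2 (s2.subset ha))]
    unfold PermCond
    simp only [blockIdx_eq π hπc]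
    constructor
    · rintro ⟨_, _, c1, c2, c3⟩
      constructor
      · intro i hi
        rw [hU, hU]
        exact c1 (i + 1) (by omega) (by omega)
      · intro i hi
        rw [List.length_cons, hWl] at hi
        cases i with
        | zero =>
          rw [List.getElem_cons_succ, hW]
          exact c2 (by omega)
        | succ i =>
          rw [List.getElem_cons_succ, List.getElem_cons_succ, hW, hW]
          exact c3 (l + 1 + i) (by omega) (by omega)
    · rintro ⟨c1, c2⟩
      refine ⟨h'.perm hπ.symm, hπc, ?_, ?_, ?_⟩
      · intro a ha hal
        have := c1 (a - 1) (by omega)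
        rw [hU, hU] at this
        rwa [show a - 1 + 1 = a by omega] at this
      · intro hlt
        have := c2 0 (by rw [List.length_cons, hWl]; omega)
        rw [List.getElem_cons_succ, hW] at this
        exact this
      · intro a ha han
        have := c2 (a - (l + 1) + 1) (by rw [List.length_cons, hWl]; omega)
        rw [List.getElem_cons_succ, List.getElem_cons_succ, hW, hW] at this
        rwa [show l + 1 + (a - (l + 1)) = a by omega,
          show l + 1 + (a - (l + 1) + 1) = a + 1 by omega] at this
  constructor
  · intro hπ
    have hperm : π.Perm ({v 1} :: (UL n l v ++ WL n l v)) := by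
      rw [List.perm_ext_iff_of_nodup hπ.1.nodup hnd]
      have mem_iff : ∀ L : List (Finset (Fin n)), IsOSP Finset.univ L → (∀ B ∈ L, B.card = 1) →
          ∀ B, B ∈ L ↔ B.card = 1 := by
        intro L hL hc B
        refine ⟨hc B, fun hB => ?_⟩
        obtain ⟨a, rfl⟩ := Finset.card_eq_one.1 hB
        have : a ∈ lUnion L := by rw [hL.2.2]; simp
        obtain ⟨C, hC, haC⟩ := (mem_lUnion _ _).1 this
        obtain ⟨c, rfl⟩ := Finset.card_eq_one.1 (hc C hC)
        rw [Finset.mem_singleton] at haC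
        rwa [haC]
      intro B
      rw [mem_iff π hπ.1 hπ.2.1, mem_iff _ h' hcard]
    obtain ⟨q1, q2⟩ := (key π hperm).1 hπ
    have hπn : π.Nodup := hπ.1.nodup
    cases π with
    | nil => simp at q1
    | cons c σ =>
      by_cases hc : c = {v 1}
      · subst hc
        refine ⟨σ, mem_shF.2 ⟨?_, ?_, ?_⟩, rfl⟩
        · simpa using hperm
        · simpa using q1
        · simpa using q2
      · exfalso
        have q1' : (({v 1} : Finset (Fin n)) :: UL n l v).Sublist σ := by
          cases q1 with
          | cons _ h => exact h
          | cons_cons _ h => exact absurd rfl hc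
        have q2' : (({v 1} : Finset (Fin n)) :: WL n l v).Sublist σ := by
          cases q2 with
          | cons _ h => exact h
          | cons_cons _ h => exact absurd rfl hc
        have hcs : c ∉ σ := (List.nodup_cons.1 hπn).1
        have : c ∈ ({v 1} : Finset (Fin n)) :: (UL n l v ++ WL n l v) := hperm.mem_iff.1 (by simp)
        rcases List.mem_cons.1 this with h | h
        · exact hc h
        · rcases List.mem_append.1 h with h | h
          · exact hcs (q1'.subset (List.mem_cons_of_mem _ h))
          · exact hcs (q2'.subset (List.mem_cons_of_mem _ h))
  · rintro ⟨σ, hσ, rfl⟩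
    obtain ⟨r1, r2, r3⟩ := mem_shF.1 hσ
    exact (key _ (r1.cons _)).2 ⟨r2.cons_cons _, r3.cons_cons _⟩

/-- the hyperplane `x_S = 0` in `V₀` -/
def WS {n : ℕ} (S : Finset (Fin n)) : Submodule ℝ (Fin n → ℝ) where
  carrier := {x | x ∈ V0 n ∧ ∑ j ∈ S, x j = 0}
  zero_mem' := ⟨Submodule.zero_mem _, by simp⟩
  add_mem' := by
    rintro x y ⟨h1, h2⟩ ⟨h3, h4⟩
    exact ⟨Submodule.add_mem _ h1 h3, by simp [Finset.sum_add_distrib, h2, h4]⟩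
  smul_mem' := by
    rintro c x ⟨h1, h2⟩
    exact ⟨Submodule.smul_mem _ _ h1, by simp [← Finset.mul_sum, h2]⟩

theorem WS_lt {n : ℕ} (S : Finset (Fin n)) (h1 : S.Nonempty) (h2 : S ≠ Finset.univ) :
    WS S < V0 n := by
  refine lt_of_le_of_ne (fun x hx => hx.1) ?_
  intro he
  obtain ⟨a, ha⟩ := h1
  obtain ⟨b, hb⟩ : ∃ b, b ∉ S := by
    by_contra hcon
    push Not at hcon
    exact h2 (Finset.eq_univ_iff_forall.2 hcon)
  have hV : (Pi.single a 1 - Pi.single b 1 : Fin n → ℝ) ∈ V0 n := by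
    simp [V0, sumLin, LinearMap.mem_ker]
  rw [← he] at hV
  have := hV.2
  simp [ha, hb] at this

/-- straightening in `𝒫₁ⁿ`.  Let `(i_l, i_{l−1},…,i₁,i_{l+1},…,i_n)` be
a permutation of `{1,…,n}` (with `v a = i_a`).  There exist a `ℚ`-linear combination `N`
of indicators of plates of ordered set partitions having a block of size at least 2, and a
function `Z` vanishing outside a finite union of proper linear subspaces of `V₀ⁿ`, with
`[[i_l,…,i₁,i_{l+1},…,i_n]] = (−1)^{l−1} ∑_π [[π]] + N + Z`, the sum being over the
permutations `π` described in `PermCond`. -/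
theorem statement_16 (n l : ℕ) (hl : 1 ≤ l) (hln : l ≤ n) (v : ℕ → Fin n)
    (hOSP : IsOSP Finset.univ (arrList n n l fun i => ({v i} : Finset (Fin n)))) :
    ∃ N : (Fin n → ℝ) → ℚ,
      N ∈ Submodule.span ℚ {f : (Fin n → ℝ) → ℚ |
        ∃ L : List (Finset (Fin n)), IsOSP Finset.univ L ∧ (∃ B ∈ L, 2 ≤ B.card) ∧
          f = ind (plate L)} ∧
      ∃ (m : ℕ) (W : Fin m → Submodule ℝ (Fin n → ℝ)),
        (∀ j, W j < V0 n) ∧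
        ∃ Z : (Fin n → ℝ) → ℚ,
          (∀ x ∈ V0 n, (∀ j, x ∉ W j) → Z x = 0) ∧
          ∀ x : Fin n → ℝ,
            ind (plate (arrList n n l fun i => ({v i} : Finset (Fin n)))) x =
            (-1 : ℚ) ^ (l - 1) *
              (∑ᶠ π ∈ {π : List (Finset (Fin n)) | PermCond n l v π}, ind (plate π) x) +
            N x + Z x := by
  rw [arr_eq n l hl v] at hOSP ⊢
  have hm := main_mem {v 1} (UL n l v) (WL n l v) hOSP
  have hlen : (UL n l v).length = l - 1 := by simp [UL]
  rw [hlen] at hm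
  have hset : {π : List (Finset (Fin n)) | PermCond n l v π} =
      ((shF (UL n l v) (WL n l v)).image (List.cons {v 1}) : Finset _) := by
    ext π
    rw [Set.mem_ofPred_eq, permCond_iff n l hl hln v hOSP π]
    simp
  have hsum : ∀ x : Fin n → ℝ,
      (∑ᶠ π ∈ {π : List (Finset (Fin n)) | PermCond n l v π}, ind (plate π) x) =
      ∑ σ ∈ shF (UL n l v) (WL n l v), ind (plate ({v 1} :: σ)) x := by
    intro x
    rw [hset, finsum_mem_coe_finset, Finset.sum_image]
    intro a _ b _ hab
    simpa using hab
  obtain ⟨N, hN, Z, hZ, hNZ⟩ := Submodule.mem_sup.1 hm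
  refine ⟨N, hN, ?_⟩
  let T := {S : Finset (Fin n) // S.Nonempty ∧ S ≠ Finset.univ}
  let e := Fintype.equivFin T
  refine ⟨Fintype.card T, fun j => WS (e.symm j).1,
    fun j => WS_lt _ (e.symm j).2.1 (e.symm j).2.2, Z, ?_, ?_⟩
  · intro x hx hxW
    apply hZ x
    refine ⟨hx, fun S h1 h2 h3 => ?_⟩
    refine hxW (e ⟨S, h1, h2⟩) ?_
    change x ∈ WS (e.symm (e ⟨S, h1, h2⟩)).1
    rw [Equiv.symm_apply_apply]
    exact ⟨hx, h3⟩
  · intro x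
    have := congrFun hNZ x
    simp only [Pi.add_apply, Pi.sub_apply, Pi.smul_apply, Finset.sum_apply, smul_eq_mul] at this
    rw [hsum]
    linarith

end PlatesPaper
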